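/- arXiv:2604.21319 — 2 statements merged into one kernel-verified Lean document; each statement's English description precedes it below -/
import Mathlib

section
/- Let 0 < β < α < 1 with α + β > 1, λ ≥ 0, φ, ψ ∈ ℝ, and f ∈ C[0,T]. Define y(t) by the representation (12): y(t) = φ E₂^{(1)}(-λt^{α+β}, -t^α) + (φ+ψ) t^α E₂^{(2)}(-λt^{α+β}, -t^α) + ∫_0^t τ^{α+β-1} E₂^{(3)}(-λτ^{α+β}, -τ^α) f(t-τ) dτ, where E₂^{(1)}, E₂^{(2)}, E₂^{(3)} are bivariate Mittag-Leffler functions with parameters (γ₁,α₁,β₁;γ₂,α₂) = (1,1,1;1,0) and δ₁ equal to 1, α+1, α+β respectively, and remaining parameters (α₃,β₂) = (α+β, α), (δ₂,α₄;δ₃,β₃) = (1,1;1,1). Then y satisfies the initial conditions y(0⁺) = φ and D_t^α y(0⁺) = ψ. -/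
open Real MeasureTheory Filter Topology

/-- Real bivariate Mittag-Leffler function with parameter set
`(1,1,1;1,0;δ₁,a,b;1,1;1,1)`: `E₂(x,y) = ∑_{m,n≥0} Γ(m+n+1) x^m y^n / (Γ(δ₁+am+bn) m! n!)`. -/
noncomputable def E2R (δ₁ a b : ℝ) (x y : ℝ) : ℝ :=
  ∑' p : ℕ × ℕ, Real.Gamma (p.1 + p.2 + 1) * x ^ p.1 * y ^ p.2 /
    (Real.Gamma (δ₁ + a * p.1 + b * p.2) * p.1.factorial * p.2.factorial)

/-- Caputo fractional derivative of order `α ∈ (0,1)`. -/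
noncomputable def caputo (α : ℝ) (f : ℝ → ℝ) (t : ℝ) : ℝ :=
  (1 / Real.Gamma (1 - α)) * ∫ ξ in (0:ℝ)..t, deriv f ξ * (t - ξ) ^ (-α)

noncomputable def PS (c s : ℕ × ℕ → ℝ) (t : ℝ) : ℝ := ∑' p, c p * t ^ (s p)

noncomputable def cc (δ a b lam : ℝ) (p : ℕ × ℕ) : ℝ :=
  Real.Gamma (p.1 + p.2 + 1) * (-lam) ^ p.1 * (-1) ^ p.2 /
    (Real.Gamma (δ + a * p.1 + b * p.2) * p.1.factorial * p.2.factorial)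

lemma gamma_half_le {x : ℝ} (hx : 1 ≤ x) : 1 / 2 ≤ Real.Gamma x := by
  have hx0 : 0 < x := by linarith
  have h2 : ∀ z : ℝ, 2 ≤ z → 1 ≤ Real.Gamma z := by
    intro z hz
    have := Real.Gamma_strictMonoOn_Ici.monotoneOn (Set.mem_Ici.2 le_rfl) (Set.mem_Ici.2 hz) hz
    rwa [Real.Gamma_two] at this
  by_cases h : 2 ≤ x
  · linarith [h2 x h]
  · have h1 := h2 (x + 1) (by linarith)
    rw [Real.Gamma_add_one hx0.ne'] at h1
    have := Real.Gamma_pos_of_pos hx0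
    nlinarith

lemma cc_bound {δ a b lam : ℝ} (hδ : 1 ≤ δ) (ha : 0 ≤ a) (hb : 0 ≤ b) (hl : 0 ≤ lam)
    (p : ℕ × ℕ) : |cc δ a b lam p| ≤ 2 * ((2 * lam) ^ p.1 * 2 ^ p.2) := by
  obtain ⟨m, n⟩ := p
  have hG : 1 / 2 ≤ Real.Gamma (δ + a * m + b * n) := by
    apply gamma_half_le
    have : 0 ≤ a * m := by positivity
    have : 0 ≤ b * n := by positivity
    linarith
  have hGp : 0 < Real.Gamma (δ + a * m + b * n) := by linarith
  have hfac : Real.Gamma ((m : ℝ) + n + 1) = ((m + n).choose m : ℝ) * m.factorial * n.factorial := by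
    have := Real.Gamma_nat_eq_factorial (m + n)
    push_cast at this
    rw [this, ← Nat.choose_symm_add.symm]
    exact_mod_cast (Nat.add_choose_mul_factorial_mul_factorial m n).symm
  have hch : ((m + n).choose m : ℝ) ≤ 2 ^ (m + n) := by
    exact_mod_cast Nat.choose_le_two_pow (m + n) m
  have hm : (m.factorial : ℝ) ≠ 0 := by positivity
  have hn : (n.factorial : ℝ) ≠ 0 := by positivity
  have e : cc δ a b lam (m, n) =
      ((m + n).choose m : ℝ) * (-lam) ^ m * (-1) ^ n * (Real.Gamma (δ + a * m + b * n))⁻¹ := by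
    simp only [cc]
    rw [hfac]
    field_simp
  rw [e, abs_mul, abs_mul, abs_mul, abs_pow, abs_pow, abs_neg, abs_neg, abs_one, one_pow,
    abs_of_nonneg hl, abs_of_pos (inv_pos.2 hGp), abs_of_nonneg (by positivity)]
  have hi : (Real.Gamma (δ + a * m + b * n))⁻¹ ≤ 2 := by
    rw [inv_le_comm₀ hGp (by norm_num)]; linarith
  calc _ ≤ (2 : ℝ) ^ (m + n) * lam ^ m * 1 * 2 := by gcongr
    _ = _ := by simp only; rw [pow_add, mul_pow]; ring

lemma term_eq {a b t : ℝ} (ha : 0 ≤ a) (hb : 0 ≤ b) (ht : 0 ≤ t) (m n : ℕ) :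
    t ^ (a * m + b * n) = (t ^ a) ^ m * (t ^ b) ^ n := by
  rw [Real.rpow_add_of_nonneg ht (by positivity) (by positivity), Real.rpow_mul ht,
    Real.rpow_mul ht, Real.rpow_natCast, Real.rpow_natCast]

lemma E2R_eq {δ a b lam e t : ℝ} (ha : 0 ≤ a) (hb : 0 ≤ b) (ht : 0 ≤ t) (he : 0 ≤ e) :
    t ^ e * E2R δ a b (-lam * t ^ a) (-(t ^ b)) =
      PS (cc δ a b lam) (fun p => e + (a * p.1 + b * p.2)) t := by
  unfold E2R PS
  rw [← tsum_mul_left]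
  congr 1
  ext ⟨m, n⟩
  simp only [cc]
  rw [Real.rpow_add_of_nonneg ht he (by positivity), term_eq ha hb ht, mul_pow,
    neg_pow (t ^ b)]
  ring

lemma summ {δ a b lam e R : ℝ} (hδ : 1 ≤ δ) (ha : 0 ≤ a) (hb : 0 ≤ b) (hl : 0 ≤ lam)
    (hR : 0 ≤ R) (he : 0 ≤ e) (h1 : 2 * lam * R ^ a < 1) (h2 : 2 * R ^ b < 1) :
    Summable (fun p : ℕ × ℕ => |cc δ a b lam p| * R ^ (e + (a * p.1 + b * p.2))) := by
  have hs : Summable (fun p : ℕ × ℕ => (2 * lam * R ^ a) ^ p.1 * (2 * R ^ b) ^ p.2) :=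
    (summable_geometric_of_lt_one (by positivity) h1).mul_of_nonneg
      (summable_geometric_of_lt_one (by positivity) h2) (fun _ => by positivity)
      (fun _ => by positivity)
  refine Summable.of_nonneg_of_le (fun p => by positivity) (fun p => ?_) (hs.mul_left (2 * R ^ e))
  rw [Real.rpow_add_of_nonneg hR he (by positivity), term_eq ha hb hR]
  calc _ ≤ 2 * ((2 * lam) ^ p.1 * 2 ^ p.2) * (R ^ e * ((R ^ a) ^ p.1 * (R ^ b) ^ p.2)) := by
        gcongr
        exact cc_bound hδ ha hb hl p
    _ = _ := by rw [mul_pow (2 * lam), mul_pow 2 (R ^ b)]; ring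

lemma PS_summ {c s : ℕ × ℕ → ℝ} {R t : ℝ} (hs : ∀ p, 0 ≤ s p) (ht : 0 ≤ t) (htR : t ≤ R)
    (h : Summable (fun p => |c p| * R ^ (s p))) : Summable (fun p => |c p| * t ^ (s p)) := by
  refine Summable.of_nonneg_of_le (fun p => by positivity) (fun p => ?_) h
  gcongr
  exact hs p

lemma PS_summ' {c s : ℕ × ℕ → ℝ} {R t : ℝ} (hs : ∀ p, 0 ≤ s p) (ht : 0 ≤ t) (htR : t ≤ R)
    (h : Summable (fun p => |c p| * R ^ (s p))) : Summable (fun p => c p * t ^ (s p)) := by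
  refine Summable.of_norm ?_
  refine (PS_summ hs ht htR h).congr fun p => ?_
  rw [norm_mul, Real.norm_eq_abs, Real.norm_of_nonneg (by positivity)]

lemma PS_diff {c s : ℕ × ℕ → ℝ} {R t u : ℝ} (hs : ∀ p, 0 ≤ s p) (hu : 0 ≤ u) (hut : u ≤ t)
    (htR : t ≤ R) (h : Summable (fun p => |c p| * R ^ (s p))) :
    |PS c s t - PS c s u| ≤ PS (fun p => |c p|) s t - PS (fun p => |c p|) s u := by
  have ht : 0 ≤ t := hu.trans hut
  unfold PS
  rw [← (PS_summ' hs ht htR h).tsum_sub (PS_summ' hs hu (hut.trans htR) h),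
    ← (PS_summ hs ht htR h).tsum_sub (PS_summ hs hu (hut.trans htR) h), ← Real.norm_eq_abs]
  refine tsum_of_norm_bounded
    ((PS_summ hs ht htR h).sub (PS_summ hs hu (hut.trans htR) h)).hasSum (fun p => ?_)
  rw [← mul_sub, ← mul_sub, norm_mul, Real.norm_eq_abs, Real.norm_of_nonneg]
  exact sub_nonneg.2 (Real.rpow_le_rpow hu hut (hs p))

lemma PS_nonneg {c s : ℕ × ℕ → ℝ} {t : ℝ} (ht : 0 ≤ t) : 0 ≤ PS (fun p => |c p|) s t :=
  tsum_nonneg fun p => by positivity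

lemma PS_abs_le {c s : ℕ × ℕ → ℝ} {R t : ℝ} (hs : ∀ p, 0 ≤ s p) (ht : 0 ≤ t) (htR : t ≤ R)
    (h : Summable (fun p => |c p| * R ^ (s p))) : |PS c s t| ≤ PS (fun p => |c p|) s R := by
  unfold PS
  rw [← Real.norm_eq_abs]
  refine tsum_of_norm_bounded h.hasSum (fun p => ?_)
  rw [norm_mul, Real.norm_eq_abs, Real.norm_of_nonneg (by positivity)]
  gcongr
  exact hs p

lemma PS_cont {c s : ℕ × ℕ → ℝ} {R : ℝ} (hs : ∀ p, 0 ≤ s p)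
    (h : Summable (fun p => |c p| * R ^ (s p))) : ContinuousOn (PS c s) (Set.Icc 0 R) := by
  unfold PS
  refine continuousOn_tsum (fun p => ?_) h (fun p t ht => ?_)
  · exact continuousOn_const.mul (continuous_id.rpow_const (fun _ => Or.inr (hs p))).continuousOn
  · rw [norm_mul, Real.norm_eq_abs, Real.norm_of_nonneg (Real.rpow_nonneg ht.1 _)]
    gcongr
    · exact ht.1
    · exact hs p
    · exact ht.2

lemma rpow_lip {s u t d : ℝ} (hs : 1 ≤ s) (hu : 0 ≤ u) (hut : u ≤ t) (htd : t ≤ d) (hd : 0 < d) :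
    |t ^ s - u ^ s| ≤ (2 * d) ^ s / d * (t - u) := by
  rw [abs_of_nonneg (sub_nonneg.2 (Real.rpow_le_rpow hu hut (by linarith)))]
  rcases hut.eq_or_lt with rfl | hlt
  · simp
  have := (convexOn_rpow hs).slope_mono_adjacent (Set.mem_Ici.2 hu)
    (Set.mem_Ici.2 (by linarith : (0:ℝ) ≤ 2 * d)) hlt (by linarith : t < 2 * d)
  have ht : 0 ≤ t := by linarith
  rw [div_le_iff₀ (by linarith)] at this
  refine this.trans ?_
  have : 0 ≤ t - u := by linarith
  gcongr
  · have := Real.rpow_nonneg ht s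
    linarith
  · linarith

/-- removal of finitely many terms leaves a Lipschitz function -/
lemma PS_lip {c s : ℕ × ℕ → ℝ} {d : ℝ} (hd : 0 < d) (S : Finset (ℕ × ℕ)) (hs : ∀ p, 0 ≤ s p)
    (hS : ∀ p ∉ S, 1 ≤ s p) (h : Summable (fun p => |c p| * (2 * d) ^ (s p))) :
    ∃ K, ∀ u t, 0 ≤ u → u ≤ t → t ≤ d →
      |(PS c s t - ∑ p ∈ S, c p * t ^ s p) - (PS c s u - ∑ p ∈ S, c p * u ^ s p)| ≤ K * (t - u) := by
  refine ⟨(∑' p, |c p| * (2 * d) ^ (s p)) / d, fun u t hu hut htd => ?_⟩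
  have key : ∀ x, 0 ≤ x → x ≤ 2 * d → HasSum (fun p => if p ∈ S then 0 else c p * x ^ s p)
      (PS c s x - ∑ p ∈ S, c p * x ^ s p) := by
    intro x h0 h1
    have A := (PS_summ' hs h0 h1 h).hasSum
    have B : HasSum (fun p => if p ∈ S then c p * x ^ s p else 0) (∑ p ∈ S, c p * x ^ s p) := by
      have := hasSum_sum_of_ne_finset_zero (s := S) (L := SummationFilter.unconditional _)
        (f := fun p => if p ∈ S then c p * x ^ s p else 0) (fun p hp => by simp [hp])
      convert this using 1
      exact Finset.sum_congr rfl fun p hp => by simp [hp]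
    have E : (fun p => if p ∈ S then 0 else c p * x ^ s p) =
        fun p => c p * x ^ s p - if p ∈ S then c p * x ^ s p else 0 := by
      ext p
      split_ifs <;> simp
    rw [E]
    exact A.sub B
  have D := (key t (by linarith) (by linarith)).sub (key u hu (by linarith))
  rw [← D.tsum_eq, ← Real.norm_eq_abs]
  have := h.hasSum.mul_right ((t - u) / d)
  rw [show (∑' p, |c p| * (2 * d) ^ (s p)) / d * (t - u) =
    (∑' p, |c p| * (2 * d) ^ (s p)) * ((t - u) / d) by ring]
  refine tsum_of_norm_bounded this (fun p => ?_)
  have htu : 0 ≤ t - u := by linarith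
  split_ifs with hp
  · simp; positivity
  · rw [← mul_sub, norm_mul, Real.norm_eq_abs, Real.norm_eq_abs, mul_assoc]
    gcongr
    refine (rpow_lip (hS p hp) hu hut htd hd).trans_eq (by ring)

lemma beta_int {α t : ℝ} (h0 : 0 < α) (h1 : α < 1) (ht : 0 < t) :
    ∫ ξ in (0:ℝ)..t, ξ ^ (α - 1) * (t - ξ) ^ (-α) = Real.Gamma α * Real.Gamma (1 - α) := by
  have h := Complex.betaIntegral_scaled (α : ℂ) ((1 - α : ℝ) : ℂ) ht
  have hb := Complex.Gamma_mul_Gamma_eq_betaIntegral (s := (α : ℂ)) (t := ((1 - α : ℝ) : ℂ))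
    (by simpa using h0) (by simpa using h1)
  have e1 : (α : ℂ) + ((1 - α : ℝ) : ℂ) = 1 := by push_cast; ring
  rw [e1, Complex.Gamma_one, one_mul] at hb
  rw [e1, sub_self, Complex.cpow_zero, one_mul, ← hb, Complex.Gamma_ofReal,
    Complex.Gamma_ofReal] at h
  have h' : ((∫ ξ in (0:ℝ)..t, ξ ^ (α - 1) * (t - ξ) ^ (-α) : ℝ) : ℂ) =
      ((Real.Gamma α * Real.Gamma (1 - α) : ℝ) : ℂ) := by
    rw [← intervalIntegral.integral_ofReal, Complex.ofReal_mul, ← h]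
    refine intervalIntegral.integral_congr fun x hx => ?_
    rw [Set.uIcc_of_le ht.le] at hx
    rw [Complex.ofReal_mul, Complex.ofReal_cpow hx.1, Complex.ofReal_cpow (by linarith [hx.2])]
    push_cast
    congr 2
    ring
  exact_mod_cast h'

lemma beta_intble {α t : ℝ} (h0 : 0 < α) (h1 : α < 1) (ht : 0 < t) :
    IntervalIntegrable (fun ξ : ℝ => ξ ^ (α - 1) * (t - ξ) ^ (-α)) volume 0 t := by
  apply intervalIntegral.intervalIntegrable_of_integral_ne_zero
  rw [beta_int h0 h1 ht]
  have := Real.Gamma_pos_of_pos h0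
  have := Real.Gamma_pos_of_pos (sub_pos.2 h1)
  positivity

lemma ker_intble {α t : ℝ} (h1 : α < 1) :
    IntervalIntegrable (fun ξ : ℝ => (t - ξ) ^ (-α)) volume 0 t := by
  have := (intervalIntegral.intervalIntegrable_rpow' (a := t) (b := 0)
    (by linarith : -1 < -α)).comp_sub_left t
  simpa using this

lemma ker_int {α t : ℝ} (h1 : α < 1) :
    ∫ ξ in (0:ℝ)..t, (t - ξ) ^ (-α) = t ^ (1 - α) / (1 - α) := by
  rw [intervalIntegral.integral_comp_sub_left (fun x => x ^ (-α)) t, sub_self, sub_zero,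
    integral_rpow (Or.inl (by linarith)), Real.zero_rpow (by linarith)]
  rw [sub_zero, show -α + 1 = 1 - α by ring]

lemma lip_abs {L : ℝ → ℝ} {d K : ℝ}
    (hL : ∀ u t, 0 ≤ u → u ≤ t → t ≤ d → |L t - L u| ≤ K * (t - u)) {u t : ℝ}
    (hu : u ∈ Set.Icc 0 d) (ht : t ∈ Set.Icc 0 d) : |L t - L u| ≤ K * |t - u| := by
  rcases le_total u t with h | h
  · rw [abs_of_nonneg (sub_nonneg.2 h)]; exact hL u t hu.1 h ht.2
  · rw [abs_sub_comm, abs_sub_comm t, abs_of_nonneg (sub_nonneg.2 h)]; exact hL t u ht.1 h hu.2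

lemma caputo_tendsto {α A φ d K : ℝ} {y : ℝ → ℝ} (h0 : 0 < α) (h1 : α < 1) (hd : 0 < d)
    (hK : 0 ≤ K)
    (hL : ∀ u t, 0 ≤ u → u ≤ t → t ≤ d →
      |(y t - (A * t ^ α + φ)) - (y u - (A * u ^ α + φ))| ≤ K * (t - u)) :
    Tendsto (caputo α y) (nhdsWithin 0 (Set.Ioi 0)) (nhds (A * Real.Gamma (α + 1))) := by
  set L : ℝ → ℝ := fun t => y t - (A * t ^ α + φ) with hLdef
  have hlip : LipschitzOnWith ⟨K, hK⟩ L (Set.Icc 0 d) := by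
    refine LipschitzOnWith.of_dist_le_mul fun x hx z hz => ?_
    exact lip_abs (L := L) hL hz hx
  have hG1 := Real.Gamma_pos_of_pos (sub_pos.2 h1)
  have hae := hlip.ae_differentiableWithinAt_of_mem_real
  have hder : ∀ ξ ∈ Set.Ioo 0 d, |deriv L ξ| ≤ K := fun ξ hξ =>
    norm_deriv_le_of_lipschitzOn (Icc_mem_nhds hξ.1 hξ.2) hlip
  have hmain : ∀ t ∈ Set.Ioo 0 d, |caputo α y t - A * Real.Gamma (α + 1)| ≤
      1 / Real.Gamma (1 - α) * (K * (t ^ (1 - α) / (1 - α))) := by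
    intro t ht
    have hcongr : ∫ ξ in (0:ℝ)..t, deriv y ξ * (t - ξ) ^ (-α) =
        ∫ ξ in (0:ℝ)..t, (A * α * (ξ ^ (α - 1) * (t - ξ) ^ (-α)) +
          deriv L ξ * (t - ξ) ^ (-α)) := by
      refine intervalIntegral.integral_congr_ae ?_
      filter_upwards [hae] with ξ hξ hm
      rw [Set.uIoc_of_le ht.1.le] at hm
      have hlt : ξ < d := hm.2.trans_lt ht.2
      have hdL : DifferentiableAt ℝ L ξ :=
        (hξ ⟨hm.1.le, hlt.le⟩).differentiableAt (Icc_mem_nhds hm.1 hlt)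
      have hp : HasDerivAt (fun x : ℝ => A * x ^ α + φ) (A * (α * ξ ^ (α - 1))) ξ :=
        ((Real.hasDerivAt_rpow_const (Or.inl hm.1.ne')).const_mul A).add_const φ
      have hy : y = fun x => L x + (A * x ^ α + φ) := by
        ext x; simp [hLdef]
      have := (hdL.hasDerivAt.add hp).deriv
      have e : deriv y ξ = deriv L ξ + A * (α * ξ ^ (α - 1)) := by
        rw [← this]; conv_lhs => rw [hy]
        rfl
      rw [e]; ring
    have hint : IntervalIntegrable (fun ξ => deriv L ξ * (t - ξ) ^ (-α)) volume 0 t := by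
      refine ((ker_intble (t := t) h1).const_mul K).mono_fun' ?_ ?_
      · apply Measurable.aestronglyMeasurable
        exact (measurable_deriv L).mul ((measurable_const.sub measurable_id).pow_const _)
      · refine (ae_restrict_iff' measurableSet_uIoc).2 (Eventually.of_forall fun ξ hm => ?_)
        rw [Set.uIoc_of_le ht.1.le] at hm
        have h3 : 0 ≤ (t - ξ) ^ (-α) := Real.rpow_nonneg (by linarith [hm.2]) _
        simp only [norm_mul, Real.norm_eq_abs, abs_of_nonneg h3]
        gcongr
        exact hder ξ ⟨hm.1, hm.2.trans_lt ht.2⟩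
    have hrem : |∫ ξ in (0:ℝ)..t, deriv L ξ * (t - ξ) ^ (-α)| ≤ K * (t ^ (1 - α) / (1 - α)) := by
      rw [← ker_int h1, ← intervalIntegral.integral_const_mul, ← Real.norm_eq_abs]
      refine intervalIntegral.norm_integral_le_of_norm_le ht.1.le
        (Eventually.of_forall fun ξ hm => ?_) ((ker_intble (t := t) h1).const_mul K)
      have h3 : 0 ≤ (t - ξ) ^ (-α) := Real.rpow_nonneg (by linarith [hm.2]) _
      rw [norm_mul, Real.norm_eq_abs, Real.norm_eq_abs, abs_of_nonneg h3]
      gcongr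
      exact hder ξ ⟨hm.1, hm.2.trans_lt ht.2⟩
    unfold caputo
    rw [hcongr, intervalIntegral.integral_add ((beta_intble h0 h1 ht.1).const_mul _) hint,
      intervalIntegral.integral_const_mul, beta_int h0 h1 ht.1, Real.Gamma_add_one h0.ne']
    rw [show 1 / Real.Gamma (1 - α) * (A * α * (Real.Gamma α * Real.Gamma (1 - α)) +
      ∫ ξ in (0:ℝ)..t, deriv L ξ * (t - ξ) ^ (-α)) - A * (α * Real.Gamma α) =
      1 / Real.Gamma (1 - α) * ∫ ξ in (0:ℝ)..t, deriv L ξ * (t - ξ) ^ (-α) by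
        field_simp; ring]
    rw [abs_mul, abs_of_pos (by positivity : 0 < 1 / Real.Gamma (1 - α))]
    gcongr
  rw [tendsto_iff_norm_sub_tendsto_zero]
  have hz : Tendsto (fun t : ℝ => 1 / Real.Gamma (1 - α) * (K * (t ^ (1 - α) / (1 - α))))
      (nhdsWithin 0 (Set.Ioi 0)) (nhds 0) := by
    have hc : Continuous (fun t : ℝ => 1 / Real.Gamma (1 - α) * (K * (t ^ (1 - α) / (1 - α)))) := by
      have := Real.continuous_rpow_const (q := 1 - α) (by linarith)
      fun_prop
    have := hc.tendsto 0
    rw [Real.zero_rpow (by linarith)] at this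
    simp only [zero_div, mul_zero] at this
    exact this.mono_left nhdsWithin_le_nhds
  refine squeeze_zero' (Eventually.of_forall fun _ => norm_nonneg _) ?_ hz
  filter_upwards [Ioo_mem_nhdsGT hd] with t ht
  exact hmain t ht

lemma conv_lip {k V f : ℝ → ℝ} {R B M : ℝ} (hk : ContinuousOn k (Set.Icc 0 R))
    (hV : ContinuousOn V (Set.Icc 0 R)) (hf : ContinuousOn f (Set.Icc 0 R))
    (hV0 : ∀ t ∈ Set.Icc 0 R, 0 ≤ V t) (hVB : ∀ t ∈ Set.Icc 0 R, V t ≤ B)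
    (hkB : ∀ t ∈ Set.Icc 0 R, |k t| ≤ B) (hM : ∀ t ∈ Set.Icc 0 R, |f t| ≤ M)
    (hkV : ∀ u t, 0 ≤ u → u ≤ t → t ≤ R → |k t - k u| ≤ V t - V u)
    (u t : ℝ) (hu : 0 ≤ u) (hut : u ≤ t) (htR : t ≤ R) :
    |(∫ τ in (0:ℝ)..t, k τ * f (t - τ)) - ∫ τ in (0:ℝ)..u, k τ * f (u - τ)| ≤
      (2 * (B * M)) * (t - u) := by
  have ht : 0 ≤ t := hu.trans hut
  have hM0 : 0 ≤ M := (abs_nonneg _).trans (hM 0 ⟨le_rfl, ht.trans htR⟩)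
  have hB0 : 0 ≤ B := (abs_nonneg _).trans (hkB 0 ⟨le_rfl, ht.trans htR⟩)
  have swap : ∀ x : ℝ, (∫ τ in (0:ℝ)..x, k τ * f (x - τ)) = ∫ s in (0:ℝ)..x, k (x - s) * f s := by
    intro x
    have := intervalIntegral.integral_comp_sub_left (a := 0) (b := x)
      (fun s => k (x - s) * f s) x
    simpa using this
  have ic : ∀ (g : ℝ → ℝ) (x v w : ℝ), ContinuousOn g (Set.Icc 0 R) → v ≤ w → w ≤ x → x - v ≤ R →
      ContinuousOn (fun s => g (x - s)) (Set.uIcc v w) := by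
    intro g x v w hg hvw hwx hxv
    rw [Set.uIcc_of_le hvw]
    exact hg.comp (by fun_prop) fun s hs => ⟨by linarith [hs.2], by linarith [hs.1]⟩
  have fc : ∀ v w, 0 ≤ v → v ≤ w → w ≤ R → ContinuousOn f (Set.uIcc v w) := by
    intro v w hv hvw hw
    rw [Set.uIcc_of_le hvw]
    exact hf.mono (Set.Icc_subset_Icc hv hw)
  have huR := hut.trans htR
  have i1 : IntervalIntegrable (fun s => k (t - s) * f s) volume 0 u :=
    ((ic k t 0 u hk hu hut (by linarith)).mul (fc 0 u le_rfl hu huR)).intervalIntegrable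
  have i2 : IntervalIntegrable (fun s => k (t - s) * f s) volume u t :=
    ((ic k t u t hk hut le_rfl (by linarith)).mul (fc u t hu hut htR)).intervalIntegrable
  have i3 : IntervalIntegrable (fun s => k (u - s) * f s) volume 0 u :=
    ((ic k u 0 u hk hu le_rfl (by linarith)).mul (fc 0 u le_rfl hu huR)).intervalIntegrable
  have v1 : IntervalIntegrable (fun s => V (t - s)) volume 0 u :=
    (ic V t 0 u hV hu hut (by linarith)).intervalIntegrable
  have v3 : IntervalIntegrable (fun s => V (u - s)) volume 0 u :=
    (ic V u 0 u hV hu le_rfl (by linarith)).intervalIntegrable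
  have vi : ∀ v w, 0 ≤ v → v ≤ w → w ≤ R → IntervalIntegrable V volume v w := by
    intro v w hv hvw hw
    apply ContinuousOn.intervalIntegrable
    rw [Set.uIcc_of_le hvw]
    exact hV.mono (Set.Icc_subset_Icc hv hw)
  have htu : 0 ≤ t - u := by linarith
  rw [swap, swap, ← intervalIntegral.integral_add_adjacent_intervals i1 i2, add_sub_right_comm,
    ← intervalIntegral.integral_sub i1 i3]
  have b2 : |∫ s in u..t, k (t - s) * f s| ≤ B * M * (t - u) := by
    have := intervalIntegral.norm_integral_le_of_norm_le_const (a := u) (b := t) (C := B * M)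
      (f := fun s => k (t - s) * f s) (fun s hs => by
        rw [Set.uIoc_of_le hut] at hs
        rw [norm_mul]
        exact mul_le_mul (hkB _ ⟨by linarith [hs.2], by linarith [hs.1]⟩)
          (hM _ ⟨by linarith [hs.1], by linarith [hs.2]⟩) (norm_nonneg _) hB0)
    rwa [abs_of_nonneg htu] at this
  have b1 : |∫ s in (0:ℝ)..u, (k (t - s) * f s - k (u - s) * f s)| ≤ B * M * (t - u) := by
    have h1 : |∫ s in (0:ℝ)..u, (k (t - s) * f s - k (u - s) * f s)| ≤
        ∫ s in (0:ℝ)..u, (V (t - s) - V (u - s)) * M := by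
      rw [← Real.norm_eq_abs]
      refine intervalIntegral.norm_integral_le_of_norm_le hu
        (Eventually.of_forall fun s hs => ?_) ((v1.sub v3).mul_const M)
      rw [← sub_mul, norm_mul]
      have := hkV (u - s) (t - s) (by linarith [hs.2]) (by linarith) (by linarith [hs.1])
      exact mul_le_mul this (hM _ ⟨hs.1.le, by linarith [hs.2]⟩) (norm_nonneg _)
        ((abs_nonneg _).trans this)
    rw [intervalIntegral.integral_mul_const, intervalIntegral.integral_sub v1 v3,
      intervalIntegral.integral_comp_sub_left V t, intervalIntegral.integral_comp_sub_left V u,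
      sub_zero, sub_zero, sub_self] at h1
    have e1 := intervalIntegral.integral_add_adjacent_intervals
      (vi 0 (t - u) le_rfl htu (by linarith)) (vi (t - u) t htu (by linarith) htR)
    have e2 := intervalIntegral.integral_add_adjacent_intervals
      (vi 0 u le_rfl hu huR) (vi u t hu hut htR)
    have n1 : 0 ≤ ∫ s in (0:ℝ)..(t - u), V s :=
      intervalIntegral.integral_nonneg htu fun s hs => hV0 s ⟨hs.1, by linarith [hs.2]⟩
    have n2 : (∫ s in u..t, V s) ≤ B * (t - u) := by
      have := intervalIntegral.integral_mono_on hut (vi u t hu hut htR)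
        (intervalIntegrable_const (c := B)) fun s hs => hVB s ⟨by linarith [hs.1], by linarith [hs.2]⟩
      simpa [mul_comm] using this
    refine h1.trans ?_
    calc _ ≤ B * (t - u) * M := by gcongr; linarith
      _ = _ := by ring
  refine (abs_add_le _ _).trans ?_
  linarith

lemma E2R_zero (δ a b : ℝ) : E2R δ a b 0 0 = 1 / Real.Gamma δ := by
  unfold E2R
  rw [tsum_eq_single ((0, 0) : ℕ × ℕ)]
  · simp
  · rintro ⟨m, n⟩ h
    rcases Nat.eq_zero_or_pos m with rfl | hm
    · have : n ≠ 0 := by rintro rfl; exact h rfl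
      simp [this]
    · simp [hm.ne']

/-- the representation (12) of the solution of the sequential Cauchy
problem satisfies the initial conditions `y(0⁺) = φ` and `D_t^α y(0⁺) = ψ`. -/
theorem representation_initial_conditions (α β lam T φ ψ : ℝ) (f : ℝ → ℝ)
    (hβ : 0 < β) (hβα : β < α) (hα : α < 1) (hαβ : 1 < α + β)
    (hlam : 0 ≤ lam) (hT : 0 < T) (hf : ContinuousOn f (Set.Icc 0 T)) :
    let y : ℝ → ℝ := fun t =>
      φ * E2R 1 (α + β) α (-lam * t ^ (α + β)) (-(t ^ α)) +
      (φ + ψ) * t ^ α * E2R (α + 1) (α + β) α (-lam * t ^ (α + β)) (-(t ^ α)) +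
      ∫ τ in (0:ℝ)..t, τ ^ (α + β - 1) *
        E2R (α + β) (α + β) α (-lam * τ ^ (α + β)) (-(τ ^ α)) * f (t - τ)
    Tendsto y (nhdsWithin 0 (Set.Ioi 0)) (nhds φ) ∧
    Tendsto (caputo α y) (nhdsWithin 0 (Set.Ioi 0)) (nhds ψ) := by
  intro y
  have h0 : 0 < α := hβ.trans hβα
  have ha : 0 ≤ α + β := by linarith
  have hGa : 0 < Real.Gamma (α + 1) := Real.Gamma_pos_of_pos (by linarith)
  -- choice of the radius
  obtain ⟨d, hd, hd1, hd2, hdT⟩ : ∃ d : ℝ, 0 < d ∧ 2 * lam * (2 * d) ^ (α + β) < 1 ∧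
      2 * (2 * d) ^ α < 1 ∧ 2 * d ≤ T := by
    have c1 : Continuous fun d : ℝ => 2 * lam * (2 * d) ^ (α + β) :=
      continuous_const.mul ((continuous_const.mul continuous_id).rpow_const fun _ => Or.inr ha)
    have c2 : Continuous fun d : ℝ => 2 * (2 * d) ^ α :=
      continuous_const.mul ((continuous_const.mul continuous_id).rpow_const fun _ => Or.inr h0.le)
    have e1 : ∀ᶠ d in nhds (0:ℝ), 2 * lam * (2 * d) ^ (α + β) < 1 := by
      refine c1.continuousAt.eventually_lt continuousAt_const ?_
      simp [Real.zero_rpow (by linarith : α + β ≠ 0)]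
    have e2 : ∀ᶠ d in nhds (0:ℝ), 2 * (2 * d) ^ α < 1 := by
      refine c2.continuousAt.eventually_lt continuousAt_const ?_
      simp [Real.zero_rpow h0.ne']
    have e3 : ∀ᶠ d in nhdsWithin (0:ℝ) (Set.Ioi 0), d ∈ Set.Ioo 0 (T / 2) :=
      Ioo_mem_nhdsGT (by linarith)
    obtain ⟨d, q1, q2, q3⟩ := ((e1.filter_mono nhdsWithin_le_nhds).and
      ((e2.filter_mono nhdsWithin_le_nhds).and e3)).exists
    exact ⟨d, q3.1, q1, q2, by linarith [q3.2]⟩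
  set q : ℝ → ℕ × ℕ → ℝ := fun e p => e + ((α + β) * p.1 + α * p.2) with hq
  have hq0 : ∀ e, 0 ≤ e → ∀ p, 0 ≤ q e p := fun e he p => by simp only [hq]; positivity
  have hsum : ∀ δ e, 1 ≤ δ → 0 ≤ e →
      Summable (fun p => |cc δ (α + β) α lam p| * (2 * d) ^ (q e p)) := fun δ e hδ he =>
    summ hδ ha h0.le hlam (by linarith) he hd1 hd2
  -- first series
  obtain ⟨K1, hK1⟩ := PS_lip hd {((0, 0) : ℕ × ℕ), (0, 1)} (hq0 0 le_rfl) (by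
    rintro ⟨m, n⟩ hp
    simp only [hq]
    rcases Nat.eq_zero_or_pos m with rfl | hm
    · have : 2 ≤ n := by
        by_contra hn
        interval_cases n <;> simp at hp
      have : (2:ℝ) ≤ n := by exact_mod_cast this
      push_cast
      nlinarith
    · have : (1:ℝ) ≤ m := by exact_mod_cast hm
      have : 0 ≤ α * n := by positivity
      nlinarith) (hsum 1 0 le_rfl le_rfl)
  obtain ⟨K2, hK2⟩ := PS_lip hd {((0, 0) : ℕ × ℕ)} (hq0 α h0.le) (by
    rintro ⟨m, n⟩ hp
    simp only [hq]
    rcases Nat.eq_zero_or_pos m with rfl | hm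
    · have : 1 ≤ n := by
        by_contra hn
        interval_cases n; simp at hp
      have : (1:ℝ) ≤ n := by exact_mod_cast this
      push_cast
      nlinarith
    · have : (1:ℝ) ≤ m := by exact_mod_cast hm
      have : 0 ≤ α * n := by positivity
      nlinarith) (hsum (α + 1) α (by linarith) h0.le)
  -- convolution
  have hs3 := hsum (α + β) (α + β - 1) hαβ.le (by linarith)
  have hq3 := hq0 (α + β - 1) (by linarith)
  set k := PS (cc (α + β) (α + β) α lam) (q (α + β - 1)) with hk
  set V := PS (fun p => |cc (α + β) (α + β) α lam p|) (q (α + β - 1)) with hV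
  have hs3' : Summable (fun p => |(|cc (α + β) (α + β) α lam p|)| * (2 * d) ^ (q (α + β - 1) p)) := by
    simpa only [abs_abs] using hs3
  have hfR : ContinuousOn f (Set.Icc 0 (2 * d)) := hf.mono (Set.Icc_subset_Icc le_rfl hdT)
  obtain ⟨M, hM⟩ := isCompact_Icc.exists_bound_of_continuousOn hfR
  have hconv := conv_lip (k := k) (V := V) (f := f) (R := 2 * d) (B := V (2 * d)) (M := M)
    (PS_cont hq3 hs3) (PS_cont hq3 hs3') hfR
    (fun t ht => PS_nonneg ht.1)
    (fun t ht => by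
      have := PS_abs_le hq3 ht.1 ht.2 hs3'
      simp only [abs_abs] at this
      exact (le_abs_self _).trans this)
    (fun t ht => PS_abs_le hq3 ht.1 ht.2 hs3) hM
    (fun u t hu hut ht => PS_diff hq3 hu hut ht hs3)
  set KY := 2 * (V (2 * d) * M) with hKY
  -- rewriting of y
  have hy : ∀ t, 0 ≤ t → y t = φ * PS (cc 1 (α + β) α lam) (q 0) t +
      (φ + ψ) * PS (cc (α + 1) (α + β) α lam) (q α) t + ∫ τ in (0:ℝ)..t, k τ * f (t - τ) := by
    intro t ht
    have r1 := E2R_eq (δ := 1) (lam := lam) ha h0.le ht (le_refl (0:ℝ))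
    have r2 := E2R_eq (δ := α + 1) (lam := lam) ha h0.le ht h0.le
    rw [Real.rpow_zero, one_mul] at r1
    have r3 : (∫ τ in (0:ℝ)..t, τ ^ (α + β - 1) *
        E2R (α + β) (α + β) α (-lam * τ ^ (α + β)) (-(τ ^ α)) * f (t - τ)) =
        ∫ τ in (0:ℝ)..t, k τ * f (t - τ) := by
      refine intervalIntegral.integral_congr fun τ hτ => ?_
      rw [Set.uIcc_of_le ht] at hτ
      have := E2R_eq (δ := α + β) (lam := lam) ha h0.le hτ.1 (by linarith : 0 ≤ α + β - 1)
      rw [this]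
    simp only [y]
    rw [r3, r1, mul_assoc, r2]
  have hLip : ∀ u t, 0 ≤ u → u ≤ t → t ≤ d →
      |(y t - (ψ / Real.Gamma (α + 1) * t ^ α + φ)) -
        (y u - (ψ / Real.Gamma (α + 1) * u ^ α + φ))| ≤
      (|φ| * K1 + |φ + ψ| * K2 + KY) * (t - u) := by
    intro u t hu hut htd
    have A1 := hK1 u t hu hut htd
    have A2 := hK2 u t hu hut htd
    have A3 := hconv u t hu hut (by linarith)
    have z1 : ∀ x : ℝ, ∑ p ∈ {((0, 0) : ℕ × ℕ), (0, 1)}, cc 1 (α + β) α lam p * x ^ q 0 p =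
        1 - x ^ α / Real.Gamma (α + 1) := by
      intro x
      rw [Finset.sum_pair (by simp)]
      have g2 : Real.Gamma (1 + 1) = 1 := by norm_num
      simp [cc, hq, g2, add_comm 1 α]
      ring
    have z2 : ∀ x : ℝ, ∑ p ∈ {((0, 0) : ℕ × ℕ)}, cc (α + 1) (α + β) α lam p * x ^ q α p =
        x ^ α / Real.Gamma (α + 1) := by
      intro x
      simp [cc, hq]
      ring
    rw [z1, z1] at A1
    rw [z2, z2] at A2
    rw [hy t (hu.trans hut), hy u hu]
    set P1t := PS (cc 1 (α + β) α lam) (q 0) t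
    set P1u := PS (cc 1 (α + β) α lam) (q 0) u
    set P2t := PS (cc (α + 1) (α + β) α lam) (q α) t
    set P2u := PS (cc (α + 1) (α + β) α lam) (q α) u
    set It := ∫ τ in (0:ℝ)..t, k τ * f (t - τ)
    set Iu := ∫ τ in (0:ℝ)..u, k τ * f (u - τ)
    set X1 := (P1t - (1 - t ^ α / Real.Gamma (α + 1))) - (P1u - (1 - u ^ α / Real.Gamma (α + 1)))
      with hX1
    set X2 := (P2t - t ^ α / Real.Gamma (α + 1)) - (P2u - u ^ α / Real.Gamma (α + 1)) with hX2
    have e : (φ * P1t + (φ + ψ) * P2t + It - (ψ / Real.Gamma (α + 1) * t ^ α + φ)) -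
        (φ * P1u + (φ + ψ) * P2u + Iu - (ψ / Real.Gamma (α + 1) * u ^ α + φ)) =
        φ * X1 + (φ + ψ) * X2 + (It - Iu) := by
      rw [hX1, hX2]; ring
    rw [e]
    calc _ ≤ |φ * X1| + |(φ + ψ) * X2| + |It - Iu| := abs_add_three _ _ _
      _ ≤ |φ| * (K1 * (t - u)) + |φ + ψ| * (K2 * (t - u)) + KY * (t - u) := by
        rw [abs_mul, abs_mul]; gcongr
      _ = _ := by ring
  set K := |φ| * K1 + |φ + ψ| * K2 + KY with hKdef
  have hK0 : 0 ≤ K := by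
    have := (abs_nonneg _).trans (hLip 0 d le_rfl hd.le le_rfl)
    rw [sub_zero] at this
    exact nonneg_of_mul_nonneg_left this hd
  constructor
  · have hy0 : y 0 = φ := by
      simp [y, Real.zero_rpow h0.ne', Real.zero_rpow (by linarith : α + β ≠ 0), E2R_zero]
    have hz : Tendsto (fun t : ℝ => K * t + |ψ / Real.Gamma (α + 1) * t ^ α|)
        (nhdsWithin 0 (Set.Ioi 0)) (nhds 0) := by
      have hc : Continuous (fun t : ℝ => K * t + |ψ / Real.Gamma (α + 1) * t ^ α|) := by
        have := Real.continuous_rpow_const (q := α) h0.le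
        fun_prop
      have := hc.tendsto 0
      simp only [Real.zero_rpow h0.ne', mul_zero, abs_zero, add_zero] at this
      exact this.mono_left nhdsWithin_le_nhds
    rw [tendsto_iff_norm_sub_tendsto_zero]
    refine squeeze_zero' (Eventually.of_forall fun _ => norm_nonneg _) ?_ hz
    filter_upwards [Ioo_mem_nhdsGT hd] with t ht
    have := hLip 0 t le_rfl ht.1.le ht.2.le
    rw [hy0, Real.zero_rpow h0.ne', mul_zero, zero_add, sub_self, sub_zero, sub_zero] at this
    rw [Real.norm_eq_abs]
    calc |y t - φ| = |(y t - (ψ / Real.Gamma (α + 1) * t ^ α + φ)) +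
          ψ / Real.Gamma (α + 1) * t ^ α| := by congr 1; ring
      _ ≤ _ := (abs_add_le _ _).trans (by gcongr)
  · have := caputo_tendsto h0 hα hd hK0 hLip
    rwa [div_mul_cancel₀ _ hGa.ne'] at this
end

section
/- Let 0 < α < 2β < 2, γ > 0, and let μ satisfy απ/2 < μ < min(απ, π). Suppose x ∈ ℂ with μ ≤ |arg(x)| ≤ π and y ∈ ℝ with -K ≤ y ≤ 0 for some K > 0. Then there exists C > 0 depending only on μ, K, α, β, γ such that the bivariate Mittag-Leffler function E₂(x,y) with parameter set (1,1,1;1,0;γ,α,β;1,1;1,1) satisfies |E₂(x,y)| ≤ C/(1+|x|). -/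
open Real Complex

/-- Bivariate Mittag-Leffler function with parameter set `(1,1,1;1,0;γ,α,β;1,1;1,1)`:
`E₂(x,y) = ∑_{m,n≥0} Γ(m+n+1) x^m y^n / (Γ(γ+αm+βn) m! n!)`. -/
noncomputable def E2 (γ α β : ℝ) (x y : ℂ) : ℂ :=
  ∑' p : ℕ × ℕ, ((Real.Gamma (p.1 + p.2 + 1) : ℝ) : ℂ) * x ^ p.1 * y ^ p.2 /
    (((Real.Gamma (γ + α * p.1 + β * p.2) : ℝ) : ℂ) * (p.1.factorial : ℂ) *
      (p.2.factorial : ℂ))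


open MeasureTheory Set Filter Topology

noncomputable def gs (s : ℝ) (ζ : ℂ) : ℂ := cexp (cexp ζ + (1 - s : ℝ) * ζ)

noncomputable def HC (d a : ℝ) (F : ℂ → ℂ) : ℂ :=
  I * (∫ t in (-d)..d, F (a + t * I)) +
    ((∫ u in Ioi a, F (u + d * I)) - ∫ u in Ioi a, F (u + (-d : ℝ) * I))

lemma HC_shift (d a b : ℝ) (hd : 0 < d) (hab : a ≤ b) (F : ℂ → ℂ)
    (hF : ∀ ζ : ℂ, a ≤ ζ.re → |ζ.im| ≤ d → DifferentiableAt ℂ F ζ)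
    (h1 : IntegrableOn (fun u : ℝ => F (u + d * I)) (Ioi a))
    (h2 : IntegrableOn (fun u : ℝ => F (u + (-d : ℝ) * I)) (Ioi a)) :
    HC d a F = HC d b F := by
  have hr := Complex.integral_boundary_rect_eq_zero_of_differentiableOn F
    (a + (-d : ℝ) * I) (b + d * I) (by
      intro ζ hζ
      simp [Complex.mem_reProdIm] at hζ
      rw [uIcc_of_le hab, uIcc_of_le (by linarith)] at hζ
      exact (hF ζ hζ.1.1 (abs_le.2 hζ.2)).differentiableWithinAt)
  have e1 := intervalIntegral.integral_interval_add_Ioi h1 (h1.mono_set (Ioi_subset_Ioi hab))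
  have e2 := intervalIntegral.integral_interval_add_Ioi h2 (h2.mono_set (Ioi_subset_Ioi hab))
  unfold HC
  rw [← e1, ← e2]
  simp only [add_re, add_im, ofReal_re, ofReal_im, mul_re, mul_im, I_re, I_im, mul_zero, mul_one, zero_add, add_zero, sub_self, smul_eq_mul] at hr
  linear_combination -hr

lemma gs_norm (s : ℝ) (u t : ℝ) : ‖gs s (u + t * I)‖ = rexp (rexp u * Real.cos t + (1 - s) * u) := by
  unfold gs
  rw [Complex.norm_exp]
  congr 1
  simp [Complex.exp_re]

lemma gs_norm' (s : ℝ) (ζ : ℂ) : ‖gs s ζ‖ = rexp (rexp ζ.re * Real.cos ζ.im + (1 - s) * ζ.re) := by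
  conv_lhs => rw [← Complex.re_add_im ζ]
  exact gs_norm _ _ _

lemma gs_cont (s : ℝ) : Continuous (gs s) := by unfold gs; fun_prop

lemma gs_tendsto (s c : ℝ) (hc : c < 0) :
    Tendsto (fun u : ℝ => rexp u * c + s * u) atTop atBot := by
  have h : Tendsto (fun u : ℝ => u * (rexp u / u * c + s)) atTop atBot := by
    apply Tendsto.atTop_mul_atBot₀ tendsto_id
    apply tendsto_atBot_add_const_right
    apply Tendsto.atTop_mul_const_of_neg hc
    simpa using Real.tendsto_exp_div_pow_atTop 1
  refine h.congr' ?_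
  filter_upwards [eventually_gt_atTop 0] with u hu
  field_simp

lemma gs_int_ray (s : ℝ) (t : ℝ) (ht : Real.cos t < 0) (a : ℝ) :
    IntegrableOn (fun u : ℝ => gs s (u + t * I)) (Ioi a) := by
  have hm : Continuous (fun u : ℝ => gs s (u + t * I)) := (gs_cont s).comp (by fun_prop)
  have hn : IntegrableOn (fun u : ℝ => ‖gs s (u + t * I)‖) (Ioi a) := by
    apply integrable_of_isBigO_exp_neg (b := 1) one_pos hm.norm.continuousOn
    apply Asymptotics.IsBigO.of_bound 1
    have := (gs_tendsto (2 - s) _ ht).eventually_le_atBot 0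
    filter_upwards [this] with u hu
    rw [norm_norm, gs_norm, one_mul, Real.norm_eq_abs, abs_of_pos (Real.exp_pos _), Real.exp_le_exp]
    linarith
  exact (integrable_norm_iff hm.aestronglyMeasurable).1 hn

lemma gs_tendsto_zero (s : ℝ) (t : ℝ) (ht : Real.cos t < 0) :
    Tendsto (fun u : ℝ => gs s (u + t * I)) atTop (𝓝 0) := by
  rw [tendsto_zero_iff_norm_tendsto_zero]
  simp only [gs_norm]
  exact Real.tendsto_exp_atBot.comp (gs_tendsto _ _ ht)

lemma gs_int_full (s : ℝ) (hs : s < 1) (t : ℝ) (ht : Real.cos t < 0) :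
    Integrable (fun u : ℝ => gs s (u + t * I)) := by
  have hm : Continuous (fun u : ℝ => gs s (u + t * I)) := (gs_cont s).comp (by fun_prop)
  rw [← integrableOn_univ, ← Iic_union_Ioi (a := 0)]
  refine IntegrableOn.union ?_ (gs_int_ray s t ht 0)
  refine Integrable.mono' (integrableOn_exp_mul_Iic (a := 1 - s) (by linarith) 0) hm.aestronglyMeasurable ?_
  refine ae_of_all _ fun u => ?_
  rw [gs_norm, Real.exp_le_exp]
  have := mul_neg_of_pos_of_neg (Real.exp_pos u) ht
  linarith

lemma gs_diff (s : ℝ) : Differentiable ℂ (gs s) := by unfold gs; fun_prop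

lemma gs_rot (s : ℝ) (hs : s < 1) (d : ℝ) (hd : π / 2 < d) (hd2 : d ≤ π) :
    ∫ u : ℝ, gs s (u + d * I) = ∫ u : ℝ, gs s (u + π * I) := by
  have hcd : Real.cos d < 0 := Real.cos_neg_of_pi_div_two_lt_of_lt hd (by linarith [Real.pi_pos])
  have hcp : Real.cos π < 0 := by simp
  have hT : Tendsto (fun T : ℝ => T) atTop atTop := tendsto_id
  have t1 := intervalIntegral_tendsto_integral (gs_int_full s hs d hcd) tendsto_neg_atTop_atBot hT
  have t2 := intervalIntegral_tendsto_integral (gs_int_full s hs π hcp) tendsto_neg_atTop_atBot hT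
  have hcos : ∀ t ∈ Set.uIoc d π, Real.cos t ≤ Real.cos d := by
    intro t ht
    rw [uIoc_of_le hd2] at ht
    exact Real.cos_le_cos_of_nonneg_of_le_pi (by linarith [Real.pi_pos]) ht.2 ht.1.le
  have t3 : Tendsto (fun T : ℝ => ∫ t in d..π, gs s ((T : ℝ) + t * I)) atTop (𝓝 0) := by
    have : Tendsto (fun T : ℝ => rexp (rexp T * Real.cos d + (1 - s) * T) * |π - d|) atTop (𝓝 0) := by
      simpa using (Real.tendsto_exp_atBot.comp (gs_tendsto (1 - s) _ hcd)).mul_const |π - d|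
    refine squeeze_zero_norm (fun T => ?_) this
    apply intervalIntegral.norm_integral_le_of_norm_le_const
    intro t ht
    rw [gs_norm, Real.exp_le_exp]
    have := mul_le_mul_of_nonneg_left (hcos t ht) (Real.exp_pos T).le
    linarith
  have t4 : Tendsto (fun T : ℝ => ∫ t in d..π, gs s (((-T : ℝ) : ℂ) + t * I)) atTop (𝓝 0) := by
    have : Tendsto (fun T : ℝ => rexp (-((1 - s) * T)) * |π - d|) atTop (𝓝 0) := by
      have := (Real.tendsto_exp_neg_atTop_nhds_zero.comp (tendsto_id.const_mul_atTop (show 0 < 1 - s by linarith))).mul_const |π - d|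
      simpa using this
    refine squeeze_zero_norm (fun T => ?_) this
    apply intervalIntegral.norm_integral_le_of_norm_le_const
    intro t ht
    rw [gs_norm, Real.exp_le_exp]
    have := mul_neg_of_pos_of_neg (Real.exp_pos (-T)) ((hcos t ht).trans_lt hcd)
    linarith
  have key : ∀ T : ℝ, (∫ u in (-T)..T, gs s (u + d * I)) - (∫ u in (-T)..T, gs s (u + π * I))
      + I * (∫ t in d..π, gs s ((T : ℝ) + t * I)) - I * (∫ t in d..π, gs s (((-T : ℝ) : ℂ) + t * I)) = 0 := by
    intro T
    have hr := Complex.integral_boundary_rect_eq_zero_of_differentiableOn (gs s)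
      ((-T : ℝ) + d * I) (T + π * I) (gs_diff s).differentiableOn
    simp only [add_re, add_im, ofReal_re, ofReal_im, mul_re, mul_im, I_re, I_im, mul_zero, mul_one, zero_add, add_zero, sub_self, smul_eq_mul] at hr
    exact hr
  have := ((t1.sub t2).add (t3.const_mul I)).sub (t4.const_mul I)
  simp only [key, mul_zero, add_zero, sub_zero] at this
  exact sub_eq_zero.1 (tendsto_nhds_unique this tendsto_const_nhds)

lemma gs_pi (s : ℝ) (hs : s < 1) :
    ∫ u : ℝ, gs s (u + π * I) = (Real.Gamma (1 - s) : ℂ) * cexp ((1 - s) * π * I) := by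
  have h := Real.integral_rpow_mul_exp_neg_mul_Ioi (a := 1 - s) (r := 1) (by linarith) one_pos
  have hi := integral_image_eq_integral_abs_deriv_smul (s := univ) (f := rexp) (f' := rexp) MeasurableSet.univ
    (fun x _ => (Real.hasDerivAt_exp x).hasDerivWithinAt) Real.exp_injective.injOn
    (fun v : ℝ => v ^ (1 - s - 1) * rexp (-(1 * v)))
  rw [image_univ, Real.range_exp, h, setIntegral_univ] at hi
  have e : ∀ u : ℝ, gs s (u + π * I) = cexp ((1 - s) * π * I) * ((|rexp u| • ((rexp u) ^ (1 - s - 1) * rexp (-(1 * rexp u))) : ℝ) : ℂ) := by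
    intro u
    rw [abs_of_pos (Real.exp_pos _), ← Real.exp_mul, smul_eq_mul, ← Real.exp_add, ← Real.exp_add, Complex.ofReal_exp, ← Complex.exp_add, gs, Complex.exp_add (u : ℂ), Complex.exp_pi_mul_I]
    congr 1
    push_cast
    ring
  simp only [e]
  rw [integral_const_mul, integral_complex_ofReal, ← hi]
  simp [mul_comm]

lemma gs_conj (s : ℝ) (u d : ℝ) : gs s (u + (-d : ℝ) * I) = (starRingEnd ℂ) (gs s (u + d * I)) := by
  unfold gs
  rw [← Complex.exp_conj]
  simp [← Complex.exp_conj]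

lemma HC_lt_one (s : ℝ) (hs : s < 1) (d : ℝ) (hd : π / 2 < d) (hd2 : d ≤ π) (a : ℝ) :
    HC d a (gs s) = 2 * π * I / (Real.Gamma s : ℂ) := by
  have hcd : Real.cos d < 0 := Real.cos_neg_of_pi_div_two_lt_of_lt hd (by linarith [Real.pi_pos])
  have hcd' : Real.cos (-d) < 0 := by simpa using hcd
  have hpi := Real.pi_pos
  have hJ : (∫ u : ℝ, gs s (u + d * I)) - (∫ u : ℝ, gs s (u + (-d : ℝ) * I)) = 2 * π * I / (Real.Gamma s : ℂ) := by
    simp only [gs_conj]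
    rw [integral_conj, gs_rot s hs d hd hd2, gs_pi s hs]
    rw [Complex.sub_conj]
    have h2 := Real.Gamma_mul_Gamma_one_sub s
    have h3 : ((Real.Gamma (1 - s) : ℂ) * cexp ((1 - s) * π * I)).im = Real.Gamma (1 - s) * Real.sin (π * s) := by
      rw [Complex.im_ofReal_mul]
      have : ((1 - s) * π * I : ℂ) = ((π - π * s : ℝ) : ℂ) * I := by push_cast; ring
      rw [this, Complex.exp_ofReal_mul_I_im, Real.sin_pi_sub]
    rw [h3]
    have h4 : Real.Gamma (1 - s) * Real.sin (π * s) = π / Real.Gamma s := by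
      have hg : 0 < Real.Gamma (1 - s) := Real.Gamma_pos_of_pos (by linarith)
      by_cases hsin : Real.sin (π * s) = 0
      · rw [hsin, div_zero] at h2
        have : Real.Gamma s = 0 := by
          rcases mul_eq_zero.1 h2 with h | h
          · exact h
          · exact absurd h hg.ne'
        simp [this, hsin]
      · have : Real.Gamma s ≠ 0 := by
          intro h
          rw [h, zero_mul, eq_comm, div_eq_zero_iff] at h2
          rcases h2 with h | h
          · exact hpi.ne' h
          · exact hsin h
        rw [eq_div_iff hsin] at h2
        rw [eq_div_iff this]; linarith
    rw [h4]; push_cast; ring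
  rw [← hJ]
  have hA : Tendsto (fun b : ℝ => HC d b (gs s)) atBot (𝓝 ((∫ u : ℝ, gs s (u + d * I)) - (∫ u : ℝ, gs s (u + (-d : ℝ) * I)))) := by
    have t1 := (aecover_Ioi (μ := volume) (tendsto_id (α := ℝ) (x := atBot))).integral_tendsto_of_countably_generated (gs_int_full s hs d hcd)
    have t2 := (aecover_Ioi (μ := volume) (tendsto_id (α := ℝ) (x := atBot))).integral_tendsto_of_countably_generated (gs_int_full s hs (-d) hcd')
    have t3 : Tendsto (fun b : ℝ => ∫ t in (-d)..d, gs s ((b : ℝ) + t * I)) atBot (𝓝 0) := by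
      have : Tendsto (fun T : ℝ => rexp (rexp T + (1 - s) * T) * |d - -d|) atBot (𝓝 0) := by
        have h0 : Tendsto (fun T : ℝ => rexp T + (1 - s) * T) atBot atBot := 
          Real.tendsto_exp_atBot.add_atBot (tendsto_id.const_mul_atBot (by linarith))
        simpa using (Real.tendsto_exp_atBot.comp h0).mul_const |d - -d|
      refine squeeze_zero_norm (fun T => ?_) this
      apply intervalIntegral.norm_integral_le_of_norm_le_const
      intro t ht
      rw [gs_norm, Real.exp_le_exp]
      have := mul_le_mul_of_nonneg_left (Real.cos_le_one t) (Real.exp_pos T).le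
      linarith
    have := (t3.const_mul I).add (t1.sub t2)
    simpa [HC] using this
  have hB : Tendsto (fun b : ℝ => HC d b (gs s)) atBot (𝓝 (HC d a (gs s))) := by
    refine tendsto_const_nhds.congr' ?_
    filter_upwards [eventually_le_atBot a] with b hb
    exact (HC_shift d b a (by linarith) hb _ (fun ζ _ _ => gs_diff s ζ) (gs_int_ray s d hcd b) (gs_int_ray s (-d) hcd' b)).symm
  exact tendsto_nhds_unique hB hA

lemma gs_deriv (s : ℝ) (ζ : ℂ) : HasDerivAt (gs (s + 1)) (gs s ζ - s * gs (s + 1) ζ) ζ := by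
  have h : HasDerivAt (gs (s+1)) (cexp (cexp ζ + (1 - (s+1) : ℝ) * ζ) * (cexp ζ + (1 - (s+1) : ℝ) * 1)) ζ := by
    apply HasDerivAt.cexp
    exact (Complex.hasDerivAt_exp ζ).add ((hasDerivAt_id ζ).const_mul _)
  convert h using 1
  unfold gs
  have : cexp (cexp ζ + (1 - s : ℝ) * ζ) = cexp (cexp ζ + (1 - (s+1) : ℝ) * ζ) * cexp ζ := by
    rw [← Complex.exp_add]; congr 1; push_cast; ring
  rw [this]; push_cast; ring

lemma HC_rec (s : ℝ) (d : ℝ) (hcd : Real.cos d < 0) (a : ℝ) :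
    HC d a (gs s) = s * HC d a (gs (s + 1)) := by
  have hcd' : Real.cos (-d) < 0 := by simpa using hcd
  have hray : ∀ t : ℝ, Real.cos t < 0 → (∫ u in Ioi a, gs s (u + t * I)) - s * (∫ u in Ioi a, gs (s + 1) (u + t * I)) = - gs (s+1) (a + t * I) := by
    intro t ht
    have i1 := gs_int_ray s t ht a
    have i2 := (gs_int_ray (s+1) t ht a).const_mul (s : ℂ)
    rw [← integral_const_mul, ← integral_sub i1 i2]
    rw [integral_Ioi_of_hasDerivAt_of_tendsto' (f := fun u : ℝ => gs (s+1) (u + t * I)) (f' := fun u : ℝ => gs s (u + t * I) - s * gs (s+1) (u + t * I)) _ (i1.sub i2) (gs_tendsto_zero _ _ ht), zero_sub]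
    intro x _
    have h2 : HasDerivAt (fun u : ℝ => (u : ℂ) + t * I) 1 x := (Complex.ofRealCLM.hasDerivAt (x := x)).add_const _
    have h3 := (gs_deriv s (x + t * I)).comp x h2
    rw [mul_one] at h3
    exact h3
  have hleft : I * (∫ t in (-d)..d, gs s (a + t * I)) - s * (I * (∫ t in (-d)..d, gs (s+1) (a + t * I))) = gs (s+1) (a + d * I) - gs (s+1) (a + (-d : ℝ) * I) := by
    have c1 : Continuous fun t : ℝ => gs s (a + t * I) := (gs_cont s).comp (by fun_prop)
    have c2 : Continuous fun t : ℝ => (s : ℂ) * gs (s+1) (a + t * I) := continuous_const.mul ((gs_cont (s+1)).comp (by fun_prop))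
    have : I * (∫ t in (-d)..d, gs s (a + t * I)) - s * (I * (∫ t in (-d)..d, gs (s+1) (a + t * I))) = ∫ t in (-d)..d, (gs s (a + t * I) - s * gs (s+1) (a + t * I)) * I := by
      rw [intervalIntegral.integral_mul_const, intervalIntegral.integral_sub (c1.intervalIntegrable _ _) (c2.intervalIntegrable _ _), intervalIntegral.integral_const_mul]
      ring
    rw [this, intervalIntegral.integral_eq_sub_of_hasDerivAt (f := fun t : ℝ => gs (s+1) (a + t * I))]
    · intro x _
      have h2 : HasDerivAt (fun u : ℝ => (a : ℂ) + u * I) (1 * I) x := ((Complex.ofRealCLM.hasDerivAt (x := x)).mul_const I).const_add _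
      have h3 := (gs_deriv s (a + x * I)).comp x h2
      rw [one_mul] at h3
      exact h3
    · exact ((c1.sub c2).mul continuous_const).intervalIntegrable _ _
  have r1 := hray d hcd
  have r2 := hray (-d) hcd'
  unfold HC
  linear_combination hleft + r1 - r2

lemma HC_cont (d : ℝ) (hcd : Real.cos d < 0) : ContinuousAt (fun s : ℝ => HC d 0 (gs s)) 1 := by
  have hcd' : Real.cos (-d) < 0 := by simpa using hcd
  have hray : ∀ t : ℝ, Real.cos t < 0 → ContinuousAt (fun s : ℝ => ∫ u in Ioi (0:ℝ), gs s (u + t * I)) 1 := by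
    intro t ht
    apply continuousAt_of_dominated (bound := fun u : ℝ => ‖gs 0 (u + t * I)‖)
    · exact Eventually.of_forall fun s => ((gs_cont s).comp (by fun_prop)).aestronglyMeasurable
    · filter_upwards [lt_mem_nhds (show (0:ℝ) < 1 by norm_num)] with s hs
      rw [ae_restrict_iff' measurableSet_Ioi]
      refine ae_of_all _ fun u hu => ?_
      rw [gs_norm, gs_norm, Real.exp_le_exp]
      have := mul_pos hs (show 0 < u from hu)
      linarith
    · exact (gs_int_ray 0 t ht 0).norm
    · refine ae_of_all _ fun u => ?_
      unfold gs
      fun_prop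
  unfold HC
  refine ContinuousAt.add (ContinuousAt.mul continuousAt_const ?_) ((hray d hcd).sub (hray (-d) hcd'))
  apply Continuous.continuousAt
  apply intervalIntegral.continuous_parametric_intervalIntegral_of_continuous'
  unfold gs
  simp only [Function.uncurry_def]
  fun_prop

lemma HC_gs (s : ℝ) (hs : 0 < s) (d : ℝ) (hd : π / 2 < d) (hd2 : d ≤ π) (a : ℝ) :
    HC d a (gs s) = 2 * π * I / (Real.Gamma s : ℂ) := by
  have hcd : Real.cos d < 0 := Real.cos_neg_of_pi_div_two_lt_of_lt hd (by linarith [Real.pi_pos])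
  have hcd' : Real.cos (-d) < 0 := by simpa using hcd
  have hd0 : 0 < d := by linarith [Real.pi_pos]
  have h01 : HC d 0 (gs 1) = 2 * π * I / (Real.Gamma 1 : ℂ) := by
    have t1 := (HC_cont d hcd).tendsto.mono_left (nhdsWithin_le_nhds (s := Iio 1))
    have t2 : Tendsto (fun s : ℝ => 2 * π * I / (Real.Gamma s : ℂ)) (𝓝[<] 1) (𝓝 (2 * π * I / (Real.Gamma 1 : ℂ))) := by
      refine Tendsto.mono_left ?_ (nhdsWithin_le_nhds (s := Iio 1))
      refine tendsto_const_nhds.div ?_ (by simp)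
      refine (Complex.continuous_ofReal.tendsto _).comp ?_
      exact (Real.differentiableAt_Gamma (fun m => by have : (0:ℝ) ≤ m := m.cast_nonneg; linarith)).continuousAt.tendsto
    refine tendsto_nhds_unique t1 (t2.congr' ?_)
    filter_upwards [self_mem_nhdsWithin] with s hs
    exact (HC_lt_one s hs d hd hd2 0).symm
  have h1 : HC d a (gs 1) = 2 * π * I / (Real.Gamma 1 : ℂ) := by
    rw [← h01]
    rcases le_total a 0 with h | h
    · exact HC_shift d a 0 hd0 h _ (fun ζ _ _ => gs_diff 1 ζ) (gs_int_ray 1 d hcd a) (gs_int_ray 1 (-d) hcd' a)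
    · exact (HC_shift d 0 a hd0 h _ (fun ζ _ _ => gs_diff 1 ζ) (gs_int_ray 1 d hcd 0) (gs_int_ray 1 (-d) hcd' 0)).symm
  have main : ∀ n : ℕ, ∀ s : ℝ, 0 < s → s ≤ n + 1 → HC d a (gs s) = 2 * π * I / (Real.Gamma s : ℂ) := by
    intro n
    induction n with
    | zero =>
      intro s hs hs1
      rcases (show s ≤ 1 by simpa using hs1).lt_or_eq with h | h
      · exact HC_lt_one s h d hd hd2 a
      · rw [h]; exact h1
    | succ n ih =>
      intro s hs hs1
      by_cases h : s ≤ 1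
      · rcases h.lt_or_eq with h | h
        · exact HC_lt_one s h d hd hd2 a
        · rw [h]; exact h1
      · push Not at h
        have e := ih (s - 1) (by linarith) (by push_cast at hs1; linarith)
        rw [HC_rec _ d hcd, sub_add_cancel] at e
        have hne : s - 1 ≠ 0 := by linarith
        have hG := Real.Gamma_add_one hne
        rw [sub_add_cancel] at hG
        have hg0 : (Real.Gamma (s - 1) : ℂ) ≠ 0 := by exact_mod_cast (Real.Gamma_pos_of_pos (by linarith)).ne'
        have hne' : ((s - 1 : ℝ) : ℂ) ≠ 0 := by exact_mod_cast hne
        rw [hG]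
        rw [eq_div_iff hg0] at e
        rw [Complex.ofReal_mul, eq_div_iff (mul_ne_zero hne' hg0)]
        linear_combination e
  obtain ⟨n, hn⟩ := exists_nat_ge s
  exact main n s hs (by linarith)

lemma HC_hasSum (d a : ℝ) (hd : 0 < d) (T : ℕ × ℕ → ℂ → ℂ) (F G : ℂ → ℂ) (w : ℕ × ℕ → ℝ) (hw : Summable w)
    (hT : ∀ p, Measurable (T p)) (hG : Continuous G)
    (h1 : IntegrableOn (fun u : ℝ => G (u + d * I)) (Ioi a))
    (h2 : IntegrableOn (fun u : ℝ => G (u + (-d : ℝ) * I)) (Ioi a))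
    (hb : ∀ p (ζ : ℂ), a ≤ ζ.re → |ζ.im| ≤ d → ‖T p ζ‖ ≤ w p * ‖G ζ‖)
    (hs : ∀ ζ : ℂ, a ≤ ζ.re → |ζ.im| ≤ d → HasSum (fun p => T p ζ) (F ζ)) :
    HasSum (fun p => HC d a (T p)) (HC d a F) := by
  have hray : ∀ t : ℝ, |t| ≤ d → IntegrableOn (fun u : ℝ => G (u + t * I)) (Ioi a) →
      HasSum (fun p => ∫ u in Ioi a, T p (u + t * I)) (∫ u in Ioi a, F (u + t * I)) := by
    intro t ht hi
    apply hasSum_integral_of_dominated_convergence (fun p (u : ℝ) => w p * ‖G (u + t * I)‖)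
    · intro p
      exact ((hT p).comp (by fun_prop)).aestronglyMeasurable
    · intro p
      rw [ae_restrict_iff' measurableSet_Ioi]
      exact ae_of_all _ fun u hu => hb p _ (by simpa using (show a < u from hu).le) (by simpa using ht)
    · exact ae_of_all _ fun u => hw.mul_right _
    · simp only [tsum_mul_right]
      exact hi.norm.const_mul _
    · rw [ae_restrict_iff' measurableSet_Ioi]
      exact ae_of_all _ fun u hu => hs _ (by simpa using (show a < u from hu).le) (by simpa using ht)
  unfold HC
  refine HasSum.add (HasSum.mul_left _ ?_) ((hray d (by rw [abs_of_pos hd]) h1).sub (hray (-d) (by rw [abs_neg, abs_of_pos hd]) h2))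
  have hc : Continuous (fun t : ℝ => G (a + t * I)) := hG.comp (by fun_prop)
  have hin : ∀ t ∈ Set.uIoc (-d) d, |t| ≤ d := by
    intro t ht
    rw [uIoc_of_le (by linarith)] at ht
    exact abs_le.2 ⟨ht.1.le, ht.2⟩
  apply intervalIntegral.hasSum_integral_of_dominated_convergence (fun p (t : ℝ) => w p * ‖G (a + t * I)‖)
  · intro p
    exact ((hT p).comp (by fun_prop)).aestronglyMeasurable
  · intro p
    exact ae_of_all _ fun t ht => hb p _ (by simp) (by simpa using hin t ht)
  · exact ae_of_all _ fun u _ => hw.mul_right _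
  · simp only [tsum_mul_right]
    exact (continuous_const.mul hc.norm).intervalIntegrable _ _
  · exact ae_of_all _ fun t ht => hs _ (by simp) (by simpa using hin t ht)

noncomputable def NC (d a : ℝ) (G : ℂ → ℂ) : ℝ :=
  (∫ t in (-d)..d, ‖G (a + t * I)‖) +
    ((∫ u in Ioi a, ‖G (u + d * I)‖) + ∫ u in Ioi a, ‖G (u + (-d : ℝ) * I)‖)

lemma HC_norm_le (d a : ℝ) (hd : 0 < d) (F G : ℂ → ℂ) (w : ℝ) (hG : Continuous G)
    (h1 : IntegrableOn (fun u : ℝ => G (u + d * I)) (Ioi a))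
    (h2 : IntegrableOn (fun u : ℝ => G (u + (-d : ℝ) * I)) (Ioi a))
    (hb : ∀ (ζ : ℂ), a ≤ ζ.re → |ζ.im| ≤ d → ‖F ζ‖ ≤ w * ‖G ζ‖) :
    ‖HC d a F‖ ≤ w * NC d a G := by
  have hray : ∀ t : ℝ, |t| ≤ d → IntegrableOn (fun u : ℝ => G (u + t * I)) (Ioi a) →
      ‖∫ u in Ioi a, F (u + t * I)‖ ≤ w * ∫ u in Ioi a, ‖G (u + t * I)‖ := by
    intro t ht hi
    rw [← integral_const_mul]
    apply norm_integral_le_of_norm_le (hi.norm.const_mul _)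
    rw [ae_restrict_iff' measurableSet_Ioi]
    exact ae_of_all _ fun u hu => hb _ (by simpa using (show a < u from hu).le) (by simpa using ht)
  have r1 := hray d (by rw [abs_of_pos hd]) h1
  have r2 := hray (-d) (by rw [abs_neg, abs_of_pos hd]) h2
  have hc : Continuous (fun t : ℝ => G (a + t * I)) := hG.comp (by fun_prop)
  have r3 : ‖∫ t in (-d)..d, F (a + t * I)‖ ≤ w * ∫ t in (-d)..d, ‖G (a + t * I)‖ := by
    rw [← intervalIntegral.integral_const_mul]
    apply intervalIntegral.norm_integral_le_of_norm_le (by linarith)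
    · exact ae_of_all _ fun t ht => hb _ (by simp) (by simpa using abs_le.2 ⟨ht.1.le, ht.2⟩)
    · exact (continuous_const.mul hc.norm).intervalIntegrable _ _
  unfold HC NC
  refine (norm_add_le _ _).trans ?_
  have := norm_sub_le (∫ u in Ioi a, F (u + d * I)) (∫ u in Ioi a, F (u + (-d : ℝ) * I))
  rw [norm_mul, Complex.norm_I, one_mul, mul_add, mul_add]
  linarith

lemma NC_nonneg (d a : ℝ) (hd : 0 < d) (G : ℂ → ℂ) : 0 ≤ NC d a G := by
  unfold NC
  have h1 : 0 ≤ ∫ t in (-d)..d, ‖G (a + t * I)‖ :=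
    intervalIntegral.integral_nonneg (by linarith) fun _ _ => norm_nonneg _
  have h2 : 0 ≤ ∫ u in Ioi a, ‖G (u + d * I)‖ := integral_nonneg fun _ => norm_nonneg _
  have h3 : 0 ≤ ∫ u in Ioi a, ‖G (u + (-d : ℝ) * I)‖ := integral_nonneg fun _ => norm_nonneg _
  linarith

lemma sum_real (A B : ℝ) (hA : 0 ≤ A) (hB : 0 ≤ B) (h : A + B < 1) :
    Summable (fun p : ℕ × ℕ => ((p.2 + p.1).choose p.1 : ℝ) * B ^ p.2 * A ^ p.1) := by
  have hB1 : ‖B‖ < 1 := by rw [Real.norm_eq_abs, abs_of_nonneg hB]; linarith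
  have hs : ∀ k : ℕ, HasSum (fun n : ℕ => ((n + k).choose k : ℝ) * B ^ n * A ^ k) (1 / (1 - B) ^ (k + 1) * A ^ k) :=
    fun k => (hasSum_choose_mul_geometric_of_norm_lt_one k hB1).mul_right (A ^ k)
  rw [summable_prod_of_nonneg (fun p => by positivity)]
  refine ⟨fun k => (hs k).summable, ?_⟩
  have e : ∀ k : ℕ, ∑' n : ℕ, ((n + k).choose k : ℝ) * B ^ n * A ^ k = 1 / (1 - B) * (A / (1 - B)) ^ k := by
    intro k
    rw [(hs k).tsum_eq, div_pow, pow_succ]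
    have : 1 - B ≠ 0 := by linarith
    field_simp
  simp only [e]
  apply Summable.mul_left
  apply summable_geometric_of_lt_one
  · apply div_nonneg hA; linarith
  · rw [div_lt_one (by linarith)]; linarith

lemma sum_complex (X Y : ℂ) (h : ‖X‖ + ‖Y‖ < 1) :
    HasSum (fun p : ℕ × ℕ => ((p.2 + p.1).choose p.1 : ℂ) * Y ^ p.2 * X ^ p.1) (1 / (1 - X - Y)) := by
  have hY1 : ‖Y‖ < 1 := by linarith [norm_nonneg X]
  have hsum : Summable (fun p : ℕ × ℕ => ((p.2 + p.1).choose p.1 : ℂ) * Y ^ p.2 * X ^ p.1) := by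
    apply Summable.of_norm
    convert sum_real ‖X‖ ‖Y‖ (norm_nonneg _) (norm_nonneg _) h using 2
    simp
  have hs : ∀ k : ℕ, HasSum (fun n : ℕ => ((n + k).choose k : ℂ) * Y ^ n * X ^ k) (1 / (1 - Y) ^ (k + 1) * X ^ k) :=
    fun k => (hasSum_choose_mul_geometric_of_norm_lt_one k hY1).mul_right (X ^ k)
  have h1 := hsum.hasSum.prod_fiberwise hs
  have hn : 1 - ‖Y‖ ≤ ‖1 - Y‖ := by simpa using norm_sub_norm_le (1:ℂ) Y
  have hne : 1 - Y ≠ 0 := by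
    rw [← norm_pos_iff]; linarith
  have hq : ‖X / (1 - Y)‖ < 1 := by
    rw [norm_div, div_lt_one (by linarith)]; linarith
  have h2 := (hasSum_geometric_of_norm_lt_one hq).mul_left (1 / (1 - Y))
  have e : (fun k : ℕ => 1 / (1 - Y) ^ (k + 1) * X ^ k) = fun k : ℕ => 1 / (1 - Y) * (X / (1 - Y)) ^ k := by
    ext k
    rw [div_pow, pow_succ]; field_simp
  rw [e] at h1
  have hne2 : 1 - Y - X ≠ 0 := by
    intro h0
    have : X = 1 - Y := by linear_combination -h0
    rw [this, div_self hne] at hq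
    simp at hq
  have hv := h1.unique h2
  have : 1 / (1 - X - Y) = ∑' p : ℕ × ℕ, ((p.2 + p.1).choose p.1 : ℂ) * Y ^ p.2 * X ^ p.1 := by
    rw [hv]
    have : 1 - X - Y = 1 - Y - X := by ring
    rw [this, ← one_div, one_sub_div hne]
    field_simp
  rw [this]
  exact hsum.hasSum

lemma gs_shift (γ α β : ℝ) (m n : ℕ) (ζ : ℂ) :
    gs (γ + α * m + β * n) ζ = gs γ ζ * cexp (-α * ζ) ^ m * cexp (-β * ζ) ^ n := by
  unfold gs
  rw [← Complex.exp_nat_mul, ← Complex.exp_nat_mul, ← Complex.exp_add, ← Complex.exp_add]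
  congr 1
  push_cast
  ring

lemma norm_exp_mul (α : ℝ) (ζ : ℂ) : ‖cexp (-α * ζ)‖ = rexp (-α * ζ.re) := by
  rw [Complex.norm_exp]; simp

lemma E2_rep (α β γ : ℝ) (hα : 0 < α) (hβ : 0 < β) (hγ : 0 < γ) (d : ℝ) (hd : π / 2 < d) (hd2 : d ≤ π)
    (x y : ℂ) (b : ℝ) (hb : ‖x‖ * rexp (-α * b) + ‖y‖ * rexp (-β * b) < 1) :
    HC d b (fun ζ => gs γ ζ / (1 - x * cexp (-α * ζ) - y * cexp (-β * ζ))) = 2 * π * I * E2 γ α β x y := by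
  have hcd : Real.cos d < 0 := Real.cos_neg_of_pi_div_two_lt_of_lt hd (by linarith [Real.pi_pos])
  have hcd' : Real.cos (-d) < 0 := by simpa using hcd
  have hd0 : 0 < d := by linarith [Real.pi_pos]
  set A := ‖x‖ * rexp (-α * b) with hA
  set B := ‖y‖ * rexp (-β * b) with hB
  have hX : ∀ ζ : ℂ, b ≤ ζ.re → ‖x * cexp (-α * ζ)‖ ≤ A := by
    intro ζ hζ
    rw [norm_mul, norm_exp_mul, hA]
    gcongr ?_ * rexp ?_
    nlinarith
  have hY : ∀ ζ : ℂ, b ≤ ζ.re → ‖y * cexp (-β * ζ)‖ ≤ B := by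
    intro ζ hζ
    rw [norm_mul, norm_exp_mul, hB]
    gcongr ?_ * rexp ?_
    nlinarith
  have key := HC_hasSum d b hd0
    (fun p ζ => (((p.2 + p.1).choose p.1 : ℂ) * x ^ p.1 * y ^ p.2) * gs (γ + α * p.1 + β * p.2) ζ)
    (fun ζ => gs γ ζ / (1 - x * cexp (-α * ζ) - y * cexp (-β * ζ))) (gs γ)
    _ (sum_real A B (by positivity) (by positivity) hb)
    (fun p => (continuous_const.mul (gs_cont _)).measurable) (gs_cont γ)
    (gs_int_ray γ d hcd b) (gs_int_ray γ (-d) hcd' b)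
    (by
      intro p ζ hζ _
      have e : (((p.2 + p.1).choose p.1 : ℂ) * x ^ p.1 * y ^ p.2) * gs (γ + α * p.1 + β * p.2) ζ =
        ((p.2 + p.1).choose p.1 : ℂ) * (y * cexp (-β * ζ)) ^ p.2 * (x * cexp (-α * ζ)) ^ p.1 * gs γ ζ := by
        rw [gs_shift, mul_pow, mul_pow]; ring
      rw [e, norm_mul, norm_mul, norm_mul, norm_pow, norm_pow, Complex.norm_natCast]
      have := hX ζ hζ
      have := hY ζ hζ
      gcongr)
    (by
      intro ζ hζ _
      have := (sum_complex (x * cexp (-α * ζ)) (y * cexp (-β * ζ)) (by linarith [hX ζ hζ, hY ζ hζ])).mul_left (gs γ ζ)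
      rw [mul_one_div] at this
      refine this.congr_fun ?_
      intro p
      simp only [gs_shift, mul_pow]; ring)
  have e : ∀ p : ℕ × ℕ, HC d b (fun ζ => (((p.2 + p.1).choose p.1 : ℂ) * x ^ p.1 * y ^ p.2) * gs (γ + α * p.1 + β * p.2) ζ) =
      2 * π * I * (((Real.Gamma (p.1 + p.2 + 1) : ℝ) : ℂ) * x ^ p.1 * y ^ p.2 /
    (((Real.Gamma (γ + α * p.1 + β * p.2) : ℝ) : ℂ) * (p.1.factorial : ℂ) *
      (p.2.factorial : ℂ))) := by
    intro p
    have hl : ∀ c : ℂ, ∀ G : ℂ → ℂ, HC d b (fun ζ => c * G ζ) = c * HC d b G := by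
      intro c G
      unfold HC
      rw [intervalIntegral.integral_const_mul, integral_const_mul, integral_const_mul]
      ring
    rw [hl, HC_gs _ (by positivity) d hd hd2]
    have hg : Real.Gamma (p.1 + p.2 + 1) = ((p.1 + p.2).factorial : ℝ) := by
      rw [← Real.Gamma_nat_eq_factorial]; push_cast; rfl
    rw [hg]
    have hc : ((p.2 + p.1).choose p.1 : ℂ) * p.1.factorial * p.2.factorial = (p.1 + p.2).factorial := by
      rw [add_comm p.2 p.1, Nat.choose_symm_add]
      exact_mod_cast Nat.add_choose_mul_factorial_mul_factorial p.1 p.2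
    rw [Complex.ofReal_natCast, ← hc]
    have f1 : (p.1.factorial : ℂ) ≠ 0 := by exact_mod_cast p.1.factorial_ne_zero
    have f2 : (p.2.factorial : ℂ) ≠ 0 := by exact_mod_cast p.2.factorial_ne_zero
    have f3 : (Real.Gamma (γ + α * p.1 + β * p.2) : ℂ) ≠ 0 := by
      exact_mod_cast (Real.Gamma_pos_of_pos (by positivity)).ne'
    field_simp
  simp only [e] at key
  rw [E2, ← tsum_mul_left]
  exact key.tsum_eq.symm

lemma denom_aux (C r : ℝ) (φ : ℝ) (hC : -1 ≤ C) (hC1 : C ≤ 1) (hr : 0 ≤ r) (hφ : Real.cos φ ≤ C) :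
    √((1 - C) / 2) * (1 + r) ≤ ‖1 - r * cexp (φ * I)‖ := by
  have h2 : ‖1 - r * cexp (φ * I)‖ = √(1 - 2 * r * Real.cos φ + r ^ 2) := by
    rw [Complex.norm_eq_sqrt_sq_add_sq]
    congr 1
    simp [Complex.exp_ofReal_mul_I_re, Complex.exp_ofReal_mul_I_im]
    nlinarith [Real.sin_sq_add_cos_sq φ]
  rw [h2]
  apply Real.le_sqrt_of_sq_le
  have : 0 ≤ (1 - C) / 2 := by linarith
  rw [mul_pow, Real.sq_sqrt this]
  nlinarith [sq_nonneg (1 - r), mul_nonneg (show 0 ≤ 1 + C by linarith) (sq_nonneg (1 - r)), mul_le_mul_of_nonneg_left hφ hr]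

lemma denom_bound (α μ d : ℝ) (hα : 0 < α) (hd : 0 < d) (hdμ : α * d < μ) (hμ : μ < π)
    (x ζ : ℂ) (hx : μ ≤ |Complex.arg x|) (hζ : |ζ.im| ≤ d) :
    √((1 - Real.cos (μ - α * d)) / 2) * (1 + ‖x‖ * rexp (-α * ζ.re)) ≤ ‖1 - x * cexp (-α * ζ)‖ := by
  have e : x * cexp (-α * ζ) = ((‖x‖ * rexp (-α * ζ.re) : ℝ) : ℂ) * cexp (((Complex.arg x - α * ζ.im : ℝ) : ℂ) * I) := by
    conv_lhs => rw [← Complex.norm_mul_exp_arg_mul_I x]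
    rw [Complex.ofReal_mul, Complex.ofReal_exp, mul_assoc, mul_assoc, ← Complex.exp_add, ← Complex.exp_add]
    congr 2
    conv_lhs => rw [← Complex.re_add_im ζ]
    push_cast
    ring
  rw [e]
  apply denom_aux _ _ _ (Real.neg_one_le_cos _) (Real.cos_le_one _) (by positivity)
  set φ := Complex.arg x - α * ζ.im with hφ
  have hle := Complex.abs_arg_le_pi x
  have h1 : |α * ζ.im| ≤ α * d := by
    rw [abs_mul, abs_of_pos hα]; gcongr
  have h2 : μ - α * d ≤ |φ| := by
    have := abs_sub_abs_le_abs_sub (Complex.arg x) (α * ζ.im)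
    linarith
  have h3 : |φ| ≤ π + α * d := by
    have := abs_sub (Complex.arg x) (α * ζ.im)
    linarith
  rw [← Real.cos_abs φ]
  rcases le_total |φ| π with h | h
  · exact Real.cos_le_cos_of_nonneg_of_le_pi (by linarith) h h2
  · rw [← Real.cos_two_pi_sub |φ|]
    exact Real.cos_le_cos_of_nonneg_of_le_pi (by linarith) (by linarith) (by linarith)

/-- Lemma 4: for `0 < α < 2β < 2`, `γ > 0`, `απ/2 < μ < min(απ, π)`,
`μ ≤ |arg x| ≤ π` and `-K ≤ y ≤ 0`, one has `|E₂(x,y)| ≤ C/(1+|x|)` with `C`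
depending only on `μ, K, α, β, γ`. -/
theorem E2_asymptotic_bound (α β γ μ K : ℝ)
    (hα : 0 < α) (hαβ : α < 2 * β) (hβ : β < 1) (hγ : 0 < γ)
    (hμ1 : α * π / 2 < μ) (hμ2 : μ < min (α * π) π) (hK : 0 < K) :
    ∃ C > 0, ∀ (x : ℂ) (y : ℝ),
      μ ≤ |Complex.arg x| → |Complex.arg x| ≤ π →
      -K ≤ y → y ≤ 0 →
      ‖E2 γ α β x (y : ℂ)‖ ≤ C / (1 + ‖x‖) := by
  have hpi := Real.pi_pos
  have hβ0 : 0 < β := by linarith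
  have hμα : μ < α * π := hμ2.trans_le (min_le_left _ _)
  have hμπ : μ < π := hμ2.trans_le (min_le_right _ _)
  obtain ⟨d, hd, hdμ'⟩ : ∃ d, π / 2 < d ∧ d < μ / α := exists_between (by rw [lt_div_iff₀ hα]; linarith)
  have hdμ : α * d < μ := by rw [lt_div_iff₀ hα] at hdμ'; linarith
  have hdπ : d ≤ π := by
    by_contra h
    push Not at h
    nlinarith
  have hd0 : 0 < d := by linarith
  have hcd : Real.cos d < 0 := Real.cos_neg_of_pi_div_two_lt_of_lt hd (by linarith)
  have hcd' : Real.cos (-d) < 0 := by simpa using hcd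
  set c := √((1 - Real.cos (μ - α * d)) / 2) with hc
  have hαd : 0 < α * d := by positivity
  have hc0 : 0 < c := by
    apply Real.sqrt_pos.2
    have : Real.cos (μ - α * d) < Real.cos 0 :=
      Real.cos_lt_cos_of_nonneg_of_le_pi le_rfl (by linarith) (by linarith)
    rw [Real.cos_zero] at this
    linarith
  have hten : Tendsto (fun a : ℝ => K * rexp (-β * a)) atTop (𝓝 0) := by
    have := (Real.tendsto_exp_neg_atTop_nhds_zero.comp (tendsto_id.const_mul_atTop hβ0)).const_mul K
    simpa using this
  obtain ⟨a, ha, ha0⟩ : ∃ a : ℝ, K * rexp (-β * a) < c / 2 ∧ 0 ≤ a :=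
    ((hten.eventually_lt_const (by positivity)).and (eventually_ge_atTop 0)).exists
  have hN := NC_nonneg d a hd0 (gs (γ - α))
  refine ⟨NC d a (gs (γ - α)) / (π * c) + 1, by positivity, ?_⟩
  intro x y hx _ hy1 hy2
  have hyK : ‖(y : ℂ)‖ ≤ K := by
    rw [Complex.norm_real, Real.norm_eq_abs, abs_le]; constructor <;> linarith
  have hden : ∀ ζ : ℂ, a ≤ ζ.re → |ζ.im| ≤ d →
      c / 2 * (1 + ‖x‖ * rexp (-α * ζ.re)) ≤ ‖1 - x * cexp (-α * ζ) - y * cexp (-β * ζ)‖ := by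
    intro ζ h1 h2
    have e1 := denom_bound α μ d hα hd0 hdμ hμπ x ζ hx h2
    rw [← hc] at e1
    have e2 : ‖(y : ℂ) * cexp (-β * ζ)‖ ≤ c / 2 := by
      rw [norm_mul, norm_exp_mul]
      refine le_trans ?_ ha.le
      gcongr ?_ * rexp ?_
      nlinarith
    have e3 := norm_sub_norm_le (1 - x * cexp (-α * ζ)) (y * cexp (-β * ζ))
    have e4 : 0 ≤ c / 2 * (‖x‖ * rexp (-α * ζ.re)) := by positivity
    linarith
  have hden0 : ∀ ζ : ℂ, a ≤ ζ.re → |ζ.im| ≤ d → 1 - x * cexp (-α * ζ) - y * cexp (-β * ζ) ≠ 0 := by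
    intro ζ h1 h2
    rw [← norm_pos_iff]
    exact lt_of_lt_of_le (by positivity) (hden ζ h1 h2)
  set F : ℂ → ℂ := fun ζ => gs γ ζ / (1 - x * cexp (-α * ζ) - y * cexp (-β * ζ)) with hF
  have hFb : ∀ ζ : ℂ, a ≤ ζ.re → |ζ.im| ≤ d → ‖F ζ‖ ≤ (2 / (c * (1 + ‖x‖))) * ‖gs (γ - α) ζ‖ := by
    intro ζ h1 h2
    have e1 := hden ζ h1 h2
    have e2 : ‖gs (γ - α) ζ‖ = ‖gs γ ζ‖ * rexp (α * ζ.re) := by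
      rw [gs_norm', gs_norm', ← Real.exp_add]; congr 1; ring
    have e3 : 1 ≤ rexp (α * ζ.re) := Real.one_le_exp (by nlinarith)
    have e4 : rexp (-α * ζ.re) * rexp (α * ζ.re) = 1 := by
      rw [← Real.exp_add]; simp
    rw [hF]
    simp only
    rw [norm_div, div_le_iff₀ (lt_of_lt_of_le (by positivity) e1), e2]
    have e5 : c / 2 * (1 + ‖x‖) ≤ rexp (α * ζ.re) * ‖1 - x * cexp (-α * ζ) - y * cexp (-β * ζ)‖ := by
      calc c / 2 * (1 + ‖x‖) ≤ c / 2 * (rexp (α * ζ.re) + ‖x‖) := by gcongr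
        _ = rexp (α * ζ.re) * (c / 2 * (1 + ‖x‖ * rexp (-α * ζ.re))) := by
          linear_combination (- (c / 2 * ‖x‖)) * e4
        _ ≤ _ := by gcongr
    calc ‖gs γ ζ‖ = 2 / (c * (1 + ‖x‖)) * ‖gs γ ζ‖ * (c / 2 * (1 + ‖x‖)) := by
          have : 1 + ‖x‖ ≠ 0 := by positivity
          field_simp
      _ ≤ 2 / (c * (1 + ‖x‖)) * ‖gs γ ζ‖ * (rexp (α * ζ.re) * ‖1 - x * cexp (-α * ζ) - y * cexp (-β * ζ)‖) := by gcongr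
      _ = _ := by ring
  have hFm : Measurable F := by
    have := (gs_cont γ).measurable
    rw [hF]
    fun_prop
  have hFi : ∀ t : ℝ, Real.cos t < 0 → |t| ≤ d → IntegrableOn (fun u : ℝ => F (u + t * I)) (Ioi a) := by
    intro t ht htd
    refine Integrable.mono' ((gs_int_ray (γ - α) t ht a).norm.const_mul (2 / (c * (1 + ‖x‖))))
      (hFm.comp (by fun_prop)).aestronglyMeasurable ?_
    rw [ae_restrict_iff' measurableSet_Ioi]
    exact ae_of_all _ fun u hu => hFb _ (by simpa using (show a < u from hu).le) (by simpa using htd)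
  have hFd : ∀ ζ : ℂ, a ≤ ζ.re → |ζ.im| ≤ d → DifferentiableAt ℂ F ζ := by
    intro ζ h1 h2
    refine DifferentiableAt.div (gs_diff γ ζ) (by fun_prop) (hden0 ζ h1 h2)
  have hexp : ∀ k : ℝ, 0 < k → ∀ M : ℝ, Tendsto (fun b : ℝ => M * rexp (-k * b)) atTop (𝓝 0) := by
    intro k hk M
    have := (Real.tendsto_exp_neg_atTop_nhds_zero.comp (tendsto_id.const_mul_atTop hk)).const_mul M
    simpa using this
  have hsum := (hexp α hα ‖x‖).add (hexp β hβ0 ‖(y : ℂ)‖)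
  rw [add_zero] at hsum
  obtain ⟨b, hb, hab⟩ := ((hsum.eventually_lt_const one_pos).and (eventually_ge_atTop a)).exists
  have hrep := E2_rep α β γ hα hβ0 hγ d hd hdπ x y b hb
  have hsh := HC_shift d a b hd0 hab F hFd (hFi d hcd (by rw [abs_of_pos hd0]))
    (hFi (-d) hcd' (by rw [abs_neg, abs_of_pos hd0]))
  rw [← hF, ← hsh] at hrep
  have hle := HC_norm_le d a hd0 F (gs (γ - α)) _ (gs_cont _) (gs_int_ray _ d hcd a) (gs_int_ray _ (-d) hcd' a) hFb
  rw [hrep, norm_mul] at hle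
  have hn : ‖(2 * π * I : ℂ)‖ = 2 * π := by
    simp [abs_of_pos hpi]
  rw [hn] at hle
  have hx1 : 0 < 1 + ‖x‖ := by positivity
  have hfin : ‖E2 γ α β x y‖ ≤ NC d a (gs (γ - α)) / (π * c) / (1 + ‖x‖) := by
    rw [div_div, le_div_iff₀ (by positivity)]
    have := mul_le_mul_of_nonneg_right hle (show 0 ≤ c * (1 + ‖x‖) / 2 by positivity)
    calc _ = 2 * π * ‖E2 γ α β x y‖ * (c * (1 + ‖x‖) / 2) := by ring
      _ ≤ _ := this
      _ = _ := by field_simp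
  refine hfin.trans ?_
  gcongr
  linarith
end
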